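/- arXiv:1108.5685 — 7 statements merged into one kernel-verified Lean document; each statement's English description precedes it below -/
import Mathlib

section
/- The function x ↦ h(|x|), where h(x) = (44/9)x² − (55/9)x³ + (20/9)x⁴ for x < 1 and h(x) = x^{1/3} for x ≥ 1, is twice continuously differentiable on all of ℝ; in particular its first derivative vanishes at x = 0. -/
/-- The Ehrhard–Müller heat-transfer correlation function `h`. -/
noncomputable def emH (x : ℝ) : ℝ :=
  if x < 1 then 44/9 * x^2 - 55/9 * x^3 + 20/9 * x^4 else x ^ ((1 : ℝ)/3)

/-- Two functions differentiable on complementary closed half-lines, with matching values and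
derivatives at the common endpoint, glue to a differentiable function. -/
lemma hasDerivAt_ite_lt {f g f' g' : ℝ → ℝ} {a : ℝ}
    (hf : ∀ x ≤ a, HasDerivAt f (f' x) x) (hg : ∀ x, a ≤ x → HasDerivAt g (g' x) x)
    (h : f a = g a) (h' : f' a = g' a) (x : ℝ) :
    HasDerivAt (fun y => if y < a then f y else g y) (if x < a then f' x else g' x) x := by
  rcases lt_trichotomy x a with hx | rfl | hx
  · rw [if_pos hx]
    refine (hf x hx.le).congr_of_eventuallyEq ?_
    filter_upwards [Iio_mem_nhds hx] with y hy
    exact if_pos hy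
  · rw [if_neg (lt_irrefl x), ← hasDerivWithinAt_univ, ← Set.Iic_union_Ici (a := x)]
    refine HasDerivWithinAt.union ?_ ?_
    · rw [← h']
      refine (hf x le_rfl).hasDerivWithinAt.congr (fun y hy => ?_) (by simp [h])
      rcases (Set.mem_Iic.mp hy).lt_or_eq with hy | rfl
      · exact if_pos hy
      · simp [h]
    · refine (hg x le_rfl).hasDerivWithinAt.congr (fun y hy => ?_) (by simp)
      exact if_neg (not_lt.mpr hy)
  · rw [if_neg hx.not_gt]
    refine (hg x hx.le).congr_of_eventuallyEq ?_
    filter_upwards [Ioi_mem_nhds hx] with y hy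
    exact if_neg (not_lt.mpr (le_of_lt hy))

/-- Two functions continuous on complementary closed half-lines and agreeing at the common
endpoint glue to a continuous function. -/
lemma continuous_ite_lt {f g : ℝ → ℝ} {a : ℝ} (hf : ContinuousOn f (Set.Iic a))
    (hg : ContinuousOn g (Set.Ici a)) (h : f a = g a) :
    Continuous (fun y => if y < a then f y else g y) := by
  have key : (fun y => if y < a then f y else g y) = fun y => if y ≤ a then f y else g y := by
    funext y
    rcases lt_trichotomy y a with hy | rfl | hy
    · simp [hy, hy.le]
    · simp [h]
    · simp [hy.not_gt, hy.not_ge]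
  rw [key]
  refine continuous_if_le continuous_id continuous_const hf hg ?_
  rintro y rfl
  exact h

lemma contDiff_two_of_hasDerivAt {f f' f'' : ℝ → ℝ} (h : ∀ x, HasDerivAt f (f' x) x)
    (h' : ∀ x, HasDerivAt f' (f'' x) x) (hc : Continuous f'') : ContDiff ℝ 2 f := by
  have e : deriv f = f' := funext fun x => (h x).deriv
  have e' : deriv f' = f'' := funext fun x => (h' x).deriv
  rw [show (2 : WithTop ℕ∞) = 1 + 1 by norm_num, contDiff_succ_iff_deriv]
  refine ⟨fun x => (h x).differentiableAt, by simp, ?_⟩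
  rw [e, contDiff_one_iff_deriv, e']
  exact ⟨fun x => (h' x).differentiableAt, hc⟩

/-- The first derivative of `emH`. -/
noncomputable def emHDeriv (x : ℝ) : ℝ :=
  if x < 1 then 88/9 * x - 55/3 * x^2 + 80/9 * x^3 else 1/3 * x ^ (-(2 : ℝ)/3)

/-- The second derivative of `emH`. -/
noncomputable def emHDeriv₂ (x : ℝ) : ℝ :=
  if x < 1 then 88/9 - 110/3 * x + 80/3 * x^2 else -2/9 * x ^ (-(5 : ℝ)/3)

lemma hasDerivAt_emH (x : ℝ) : HasDerivAt emH (emHDeriv x) x := by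
  refine hasDerivAt_ite_lt (f := fun x => 44/9 * x^2 - 55/9 * x^3 + 20/9 * x^4)
    (g := fun x => x ^ ((1 : ℝ)/3))
    (f' := fun x => 88/9 * x - 55/3 * x^2 + 80/9 * x^3)
    (g' := fun x => 1/3 * x ^ (-(2 : ℝ)/3))
    (fun y _ => ?_) (fun y hy => ?_) ?_ ?_ x
  · refine HasDerivAt.congr_deriv ((((hasDerivAt_pow 2 y).const_mul (44/9)).sub
      ((hasDerivAt_pow 3 y).const_mul (55/9))).add ((hasDerivAt_pow 4 y).const_mul (20/9))) ?_
    norm_num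
    ring
  · convert Real.hasDerivAt_rpow_const (x := y) (p := 1/3) (Or.inl (by linarith)) using 2
    norm_num
  · norm_num
  · norm_num

lemma hasDerivAt_emHDeriv (x : ℝ) : HasDerivAt emHDeriv (emHDeriv₂ x) x := by
  refine hasDerivAt_ite_lt (f := fun x => 88/9 * x - 55/3 * x^2 + 80/9 * x^3)
    (g := fun x => 1/3 * x ^ (-(2 : ℝ)/3))
    (f' := fun x => 88/9 - 110/3 * x + 80/3 * x^2)
    (g' := fun x => -2/9 * x ^ (-(5 : ℝ)/3))
    (fun y _ => ?_) (fun y hy => ?_) ?_ ?_ x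
  · refine HasDerivAt.congr_deriv ((((hasDerivAt_id' y).const_mul (88/9)).sub
      ((hasDerivAt_pow 2 y).const_mul (55/3))).add ((hasDerivAt_pow 3 y).const_mul (80/9))) ?_
    norm_num
    ring
  · refine HasDerivAt.congr_deriv ((Real.hasDerivAt_rpow_const (x := y) (p := -2/3)
      (Or.inl (by linarith))).const_mul (1/3)) ?_
    norm_num
    ring
  · norm_num
  · norm_num

lemma continuous_emHDeriv₂ : Continuous emHDeriv₂ := by
  refine continuous_ite_lt (by fun_prop) ?_ (by norm_num)
  refine continuousOn_const.mul (continuousOn_id.rpow_const fun y hy => Or.inl ?_)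
  have : (1 : ℝ) ≤ y := hy
  exact (by linarith : y ≠ 0)

lemma emH_abs_eq (x : ℝ) : emH |x| = if x < 0 then emH (-x) else emH x := by
  split_ifs with h
  · rw [abs_of_neg h]
  · rw [abs_of_nonneg (not_lt.mp h)]

lemma hasDerivAt_emH_abs (x : ℝ) :
    HasDerivAt (fun y : ℝ => emH |y|) (if x < 0 then -emHDeriv (-x) else emHDeriv x) x := by
  simp only [emH_abs_eq]
  refine hasDerivAt_ite_lt (f := fun y => emH (-y)) (f' := fun y => -emHDeriv (-y))
    (fun y _ => ?_) (fun y _ => hasDerivAt_emH y) (by simp) (by simp [emHDeriv]) x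
  exact ((hasDerivAt_emH (-y)).comp y (hasDerivAt_neg y)).congr_deriv (by simp)

theorem emH_abs_contDiff_two :
    ContDiff ℝ 2 (fun x : ℝ => emH |x|) ∧ deriv (fun x : ℝ => emH |x|) 0 = 0 := by
  refine ⟨contDiff_two_of_hasDerivAt hasDerivAt_emH_abs
    (f'' := fun x => if x < 0 then emHDeriv₂ (-x) else emHDeriv₂ x) ?_ ?_, ?_⟩
  · refine hasDerivAt_ite_lt (f := fun y => -emHDeriv (-y)) (f' := fun y => emHDeriv₂ (-y))
      (fun y _ => ?_) (fun y _ => hasDerivAt_emHDeriv y) (by simp [emHDeriv]) (by simp)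
    exact ((hasDerivAt_emHDeriv (-y)).comp y (hasDerivAt_neg y)).neg.congr_deriv (by simp)
  · exact continuous_ite_lt (continuous_emHDeriv₂.comp continuous_neg).continuousOn
      continuous_emHDeriv₂.continuousOn (by simp)
  · rw [(hasDerivAt_emH_abs 0).deriv]
    simp [emHDeriv]
end

section
/- For the Ehrhard–Müller system with α > 0, K ≥ 0, and β > 1, there exists an equilibrium point with x₁ > 0 (a convecting equilibrium). Specifically, there exists c > 0 with (1 + K h(c)) + c²/(1 + K h(c)) = β, and then (c, c, c²/(1 + K h(c))) is an equilibrium of the system. -/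
/-- The Ehrhard–Müller vector field on ℝ³ with parameters α, β, K. -/
noncomputable def emField (α β K : ℝ) : ℝ × ℝ × ℝ → ℝ × ℝ × ℝ :=
  fun x => (α * (x.2.1 - x.1),
            β * x.1 - x.2.1 * (1 + K * emH |x.1|) - x.1 * x.2.2,
            x.1 * x.2.1 - x.2.2 * (1 + K * emH |x.1|))

theorem continuous_emH : Continuous emH := by
  have h : emH = fun x : ℝ =>
      if 1 ≤ x then x ^ ((1 : ℝ)/3) else 44/9 * x^2 - 55/9 * x^3 + 20/9 * x^4 := by
    funext x
    unfold emH
    split_ifs <;> first | rfl | (exfalso; linarith)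
  rw [h]
  refine Continuous.if_le (Real.continuous_rpow_const (by norm_num)) (by fun_prop)
    continuous_const continuous_id ?_
  intro x hx
  rw [← hx, Real.one_rpow]
  norm_num

theorem emH_nonneg (x : ℝ) : 0 ≤ emH x := by
  unfold emH
  split_ifs with h
  · nlinarith [mul_nonneg (sq_nonneg x) (sq_nonneg (8 * x - 11)), sq_nonneg x]
  · exact Real.rpow_nonneg (by linarith) _

/-- For `α > 0`, `K ≥ 0`, `β > 1` the Ehrhard–Müller system has a convecting
equilibrium with `x₁ > 0`. -/
theorem em_convecting_equilibrium_exists (α β K : ℝ)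
    (hα : 0 < α) (hK : 0 ≤ K) (hβ : 1 < β) :
    ∃ c : ℝ, 0 < c ∧
      (1 + K * emH c) + c ^ 2 / (1 + K * emH c) = β ∧
      emField α β K (c, c, c ^ 2 / (1 + K * emH c)) = (0, 0, 0) := by
  have hu (x : ℝ) : 0 < 1 + K * emH x := by
    have := mul_nonneg hK (emH_nonneg x)
    linarith
  have hcont : Continuous fun x : ℝ => (1 + K * emH x) + x ^ 2 / (1 + K * emH x) := by
    have hden : Continuous fun x : ℝ => 1 + K * emH x :=
      continuous_const.add (continuous_const.mul continuous_emH)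
    exact hden.add ((continuous_pow 2).div hden fun x => (hu x).ne')
  have h_zero : (1 + K * emH 0) + 0 ^ 2 / (1 + K * emH 0) = 1 := by
    simp [emH]
  have h_beta : β ≤ (1 + K * emH β) + β ^ 2 / (1 + K * emH β) := by
    have h := hu β
    rw [← sub_le_iff_le_add', le_div_iff₀ h]
    nlinarith [sq_nonneg (1 + K * emH β - β)]
  obtain ⟨c, ⟨hc0, -⟩, hc⟩ := intermediate_value_Icc (by linarith : (0 : ℝ) ≤ β)
    hcont.continuousOn ⟨h_zero.le.trans hβ.le, h_beta⟩
  have hc : (1 + K * emH c) + c ^ 2 / (1 + K * emH c) = β := hc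
  have hpos : 0 < c := by
    refine lt_of_le_of_ne hc0 fun h => ?_
    rw [← h, h_zero] at hc
    exact hβ.ne hc
  refine ⟨c, hpos, hc, ?_⟩
  simp only [emField, abs_of_pos hpos, Prod.mk.injEq]
  refine ⟨by ring, ?_, ?_⟩
  · linear_combination -c * hc
  · rw [div_mul_cancel₀ _ (hu c).ne']
    ring
end

section
/- Let B be an N×N symmetric positive definite real matrix, R an M×M symmetric positive definite real matrix, and H an M×N real matrix. Then the 3D-Var cost function C(x) = ½(x − x_b)ᵀB⁻¹(x − x_b) + ½(y − Hx)ᵀR⁻¹(y − Hx) has a unique global minimizer over ℝᴺ, given by the Kalman analysis x_a = x_b + K(y − Hx_b), where K = BHᵀ(HBHᵀ + R)⁻¹ is the Kalman gain. -/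
open Matrix

/-- Expansion of a symmetric quadratic form at a sum. -/
theorem Matrix.IsHermitian.dotProduct_mulVec_add_self {n : Type*} [Fintype n]
    {A : Matrix n n ℝ} (hA : A.IsHermitian) (a b : n → ℝ) :
    (a + b) ⬝ᵥ (A *ᵥ (a + b)) = a ⬝ᵥ (A *ᵥ a) + 2 * (b ⬝ᵥ (A *ᵥ a)) + b ⬝ᵥ (A *ᵥ b) := by
  have hT : Aᵀ = A := by simpa [conjTranspose_eq_transpose_of_trivial] using hA.eq
  have hab : a ⬝ᵥ (A *ᵥ b) = b ⬝ᵥ (A *ᵥ a) := by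
    rw [dotProduct_mulVec, ← mulVec_transpose, hT, dotProduct_comm]
  simp only [mulVec_add, dotProduct_add, add_dotProduct, hab]
  ring

/-- The innovation covariance `H * B * Hᵀ + R` is positive definite. -/
theorem Matrix.PosSemidef.posDef_mul_mul_transpose_add {m n : Type*} [Fintype m] [Fintype n]
    {B : Matrix n n ℝ} {R : Matrix m m ℝ} (hB : B.PosSemidef) (hR : R.PosDef)
    (H : Matrix m n ℝ) : (H * B * Hᵀ + R).PosDef := by
  have h := hB.mul_mul_conjTranspose_same H
  rw [conjTranspose_eq_transpose_of_trivial] at h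
  exact PosDef.posSemidef_add h hR

/-- The 3D-Var cost function has the Kalman analysis as its unique global
minimizer. -/
theorem threeDVar_unique_minimizer (N M : ℕ)
    (B : Matrix (Fin N) (Fin N) ℝ) (R : Matrix (Fin M) (Fin M) ℝ)
    (H : Matrix (Fin M) (Fin N) ℝ) (hB : B.PosDef) (hR : R.PosDef)
    (xb : Fin N → ℝ) (y : Fin M → ℝ) :
    let K := B * Hᵀ * (H * B * Hᵀ + R)⁻¹
    let xa := xb + K *ᵥ (y - H *ᵥ xb)
    let C : (Fin N → ℝ) → ℝ := fun x =>
      (1/2) * ((x - xb) ⬝ᵥ (B⁻¹ *ᵥ (x - xb))) +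
      (1/2) * ((y - H *ᵥ x) ⬝ᵥ (R⁻¹ *ᵥ (y - H *ᵥ x)))
    ∀ x : Fin N → ℝ, x ≠ xa → C xa < C x := by
  intro K xa C x hx
  have hBdet := (isUnit_iff_isUnit_det B).1 hB.isUnit
  have hRdet := (isUnit_iff_isUnit_det R).1 hR.isUnit
  have hSdet := (isUnit_iff_isUnit_det _).1
    (hB.posSemidef.posDef_mul_mul_transpose_add hR H).isUnit
  set z := (H * B * Hᵀ + R)⁻¹ *ᵥ (y - H *ᵥ xb) with hz
  set u := x - xa with hu
  have hSz : (H * B * Hᵀ + R) *ᵥ z = y - H *ᵥ xb := by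
    rw [hz, mulVec_mulVec, mul_nonsing_inv _ hSdet, one_mulVec]
  have hxa : xa = xb + (B * Hᵀ) *ᵥ z := by
    simp only [xa, K, hz, mulVec_mulVec]
  clear_value z
  have hback : xa - xb = (B * Hᵀ) *ᵥ z := by rw [hxa, add_sub_cancel_left]
  have hobs : y - H *ᵥ xa = R *ᵥ z := by
    rw [hxa, mulVec_add, ← sub_sub, ← hSz, add_mulVec, mulVec_mulVec, ← Matrix.mul_assoc,
      add_sub_cancel_left]
  have hx_back : x - xb = (xa - xb) + u := by rw [hu]; abel
  have hx_obs : y - H *ᵥ x = (y - H *ᵥ xa) + -(H *ᵥ u) := by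
    rw [hu, mulVec_sub]; abel
  have hBgrad : B⁻¹ *ᵥ (xa - xb) = Hᵀ *ᵥ z := by
    rw [hback, mulVec_mulVec, nonsing_inv_mul_cancel_left _ _ hBdet]
  have hRgrad : R⁻¹ *ᵥ (y - H *ᵥ xa) = z := by
    rw [hobs, mulVec_mulVec, nonsing_inv_mul _ hRdet, one_mulVec]
  have hcross : u ⬝ᵥ (Hᵀ *ᵥ z) = (H *ᵥ u) ⬝ᵥ z := by
    rw [dotProduct_mulVec, vecMul_transpose]
  have hu_ne : u ≠ 0 := sub_ne_zero.2 hx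
  have hBpos : 0 < u ⬝ᵥ (B⁻¹ *ᵥ u) := by
    simpa using hB.inv.dotProduct_mulVec_pos hu_ne
  have hRnonneg : 0 ≤ -(H *ᵥ u) ⬝ᵥ (R⁻¹ *ᵥ -(H *ᵥ u)) := by
    simpa using hR.inv.posSemidef.dotProduct_mulVec_nonneg (-(H *ᵥ u))
  have hBexp := hB.inv.isHermitian.dotProduct_mulVec_add_self (xa - xb) u
  have hRexp := hR.inv.isHermitian.dotProduct_mulVec_add_self (y - H *ᵥ xa) (-(H *ᵥ u))
  rw [← hx_back, hBgrad, hcross] at hBexp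
  rw [← hx_obs, hRgrad, neg_dotProduct (H *ᵥ u) z] at hRexp
  simp only [C]
  rw [hBexp, hRexp, hBgrad, hRgrad]
  linarith
end

section
/- Let B be an N×N symmetric positive semidefinite real matrix, H a 1×N real matrix (scalar observation), and R > 0 a real number. Write s = HBHᵀ ≥ 0 (a scalar) and let K = BHᵀ(s + R)⁻¹ be the Kalman gain. Then the ensemble square root filter gain K̃ = BHᵀ · (√(s + R))⁻¹ · (√(s + R) + √R)⁻¹ satisfies K̃ = (1 + √(R/(s + R)))⁻¹ K. -/
open Matrix

/-- The scalar identity relating the square-root filter factor to the Kalman factor. -/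
lemma inv_sqrt_mul_inv_sqrt_add_sqrt {t R : ℝ} (ht : 0 < t) (hR : 0 ≤ R) :
    (√t)⁻¹ * (√t + √R)⁻¹ = (1 + √(R / t))⁻¹ * t⁻¹ := by
  have hpos : 0 < √t := Real.sqrt_pos.2 ht
  rw [Real.sqrt_div hR, ← mul_inv, ← mul_inv]
  congr 1
  nth_rewrite 4 [← Real.mul_self_sqrt ht.le]
  field_simp

/-- For a scalar observation, the EnSRF gain is a scalar multiple of the Kalman
gain: `K̃ = (1 + √(R/(s+R)))⁻¹ K`. -/
theorem ensrf_gain_scalar (N : ℕ)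
    (B : Matrix (Fin N) (Fin N) ℝ) (H : Matrix (Fin 1) (Fin N) ℝ)
    (R : ℝ) (hB : B.PosSemidef) (hR : 0 < R) :
    let s : ℝ := (H * B * Hᵀ) 0 0
    let K : Matrix (Fin N) (Fin 1) ℝ := (s + R)⁻¹ • (B * Hᵀ)
    let Ktilde : Matrix (Fin N) (Fin 1) ℝ :=
      ((Real.sqrt (s + R))⁻¹ * (Real.sqrt (s + R) + Real.sqrt R)⁻¹) • (B * Hᵀ)
    0 ≤ s ∧ Ktilde = (1 + Real.sqrt (R / (s + R)))⁻¹ • K := by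
  intro s K Ktilde
  have hs : 0 ≤ s := by
    have h := (hB.mul_mul_conjTranspose_same H).diag_nonneg (i := 0)
    rwa [conjTranspose_eq_transpose_of_trivial] at h
  refine ⟨hs, ?_⟩
  simp only [Ktilde, K, smul_smul,
    inv_sqrt_mul_inv_sqrt_add_sqrt (add_pos_of_nonneg_of_pos hs hR) hR.le]
end

section
/- Let B be an N×N symmetric positive semidefinite real matrix, H a 1×N real matrix, and R > 0. Write s = HBHᵀ, K = BHᵀ/(s + R), and K̃ = (1 + √(R/(s + R)))⁻¹ K. Then (I − K̃H) B (I − K̃H)ᵀ = (I − KH)B. Hence updating the ensemble perturbations by Xᵃ = (I − K̃H)Xᵇ, where B = (1/(P−1))Xᵇ(Xᵇ)ᵀ, produces an analysis ensemble whose sample covariance (1/(P−1))Xᵃ(Xᵃ)ᵀ equals the Kalman filter analysis covariance (I − KH)B exactly, without perturbing the observations. -/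
open Matrix

/-- Expansion of `(I − cGH) B (I − cGH)ᵀ` with `G = BHᵀ` for a symmetric `B` and a single
observation row `H`. -/
lemma one_sub_smul_gain_mul_mul_transpose {n : Type*} [Fintype n] [DecidableEq n]
    {B : Matrix n n ℝ} (hB : Bᵀ = B) (H : Matrix (Fin 1) n ℝ) (c : ℝ) :
    (1 - (c • (B * Hᵀ)) * H) * B * (1 - (c • (B * Hᵀ)) * H)ᵀ =
      B - (2 * c - c ^ 2 * (H * B * Hᵀ) 0 0) • (B * Hᵀ * H * B) := by
  have hs : H * (B * Hᵀ) = (H * B * Hᵀ) 0 0 • (1 : Matrix (Fin 1) (Fin 1) ℝ) := by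
    rw [← Matrix.mul_assoc]
    ext i j
    fin_cases i
    fin_cases j
    simp
  have hq : B * (Hᵀ * (H * (B * (Hᵀ * (H * B))))) =
      (H * B * Hᵀ) 0 0 • (B * (Hᵀ * (H * B))) := by
    have h : H * (B * (Hᵀ * (H * B))) = H * (B * Hᵀ) * (H * B) := by
      simp only [Matrix.mul_assoc]
    rw [h, hs]
    simp
  simp only [transpose_sub, transpose_one, transpose_mul, transpose_smul, transpose_transpose, hB,
    Matrix.sub_mul, Matrix.mul_sub, Matrix.one_mul, Matrix.mul_one, Matrix.smul_mul,
    Matrix.mul_smul, Matrix.mul_assoc, hq]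
  module

/-- The square-root factor `(1 + √(R / (s + R)))⁻¹` of the reduced gain solves the quadratic
equation that makes the analysis covariance exact. -/
lemma reduced_gain_quadratic {s R : ℝ} (hs : 0 ≤ s) (hR : 0 < R) :
    2 * ((1 + Real.sqrt (R / (s + R)))⁻¹ * (s + R)⁻¹) -
      ((1 + Real.sqrt (R / (s + R)))⁻¹ * (s + R)⁻¹) ^ 2 * s = (s + R)⁻¹ := by
  have ht : 0 < s + R := by positivity
  have hr0 := Real.sqrt_nonneg (R / (s + R))
  have hr : Real.sqrt (R / (s + R)) ^ 2 * (s + R) = R := by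
    rw [Real.sq_sqrt (by positivity)]
    field_simp
  generalize Real.sqrt (R / (s + R)) = r at hr0 hr
  have h1 : 1 + r ≠ 0 := by positivity
  field_simp
  linear_combination -hr

/-- For a scalar observation, the EnSRF perturbation update reproduces the
Kalman analysis covariance exactly without perturbed observations:
`(I − K̃H) B (I − K̃H)ᵀ = (I − KH)B`, and hence an ensemble with sample
covariance `B` updated by `Xᵃ = (I − K̃H)Xᵇ` has sample covariance `(I − KH)B`. -/
theorem ensrf_exact_analysis_covariance (N : ℕ)
    (B : Matrix (Fin N) (Fin N) ℝ) (H : Matrix (Fin 1) (Fin N) ℝ)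
    (R : ℝ) (hB : B.PosSemidef) (hR : 0 < R) :
    let s : ℝ := (H * B * Hᵀ) 0 0
    let K : Matrix (Fin N) (Fin 1) ℝ := (s + R)⁻¹ • (B * Hᵀ)
    let Ktilde : Matrix (Fin N) (Fin 1) ℝ :=
      (1 + Real.sqrt (R / (s + R)))⁻¹ • K
    (1 - Ktilde * H) * B * (1 - Ktilde * H)ᵀ = (1 - K * H) * B ∧
    ∀ (P : ℕ), 2 ≤ P → ∀ Xb : Matrix (Fin N) (Fin P) ℝ,
      B = ((P : ℝ) - 1)⁻¹ • (Xb * Xbᵀ) →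
      ((P : ℝ) - 1)⁻¹ • (((1 - Ktilde * H) * Xb) * ((1 - Ktilde * H) * Xb)ᵀ) =
        (1 - K * H) * B := by
  intro s K Ktilde
  have hBT : Bᵀ = B := by simpa using hB.isHermitian.eq
  have hs : 0 ≤ s := by
    simpa using (hB.mul_mul_conjTranspose_same H).diag_nonneg (i := 0)
  have hcov : (1 - Ktilde * H) * B * (1 - Ktilde * H)ᵀ = (1 - K * H) * B := by
    have hK : Ktilde = ((1 + Real.sqrt (R / (s + R)))⁻¹ * (s + R)⁻¹) • (B * Hᵀ) :=
      smul_smul _ _ _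
    rw [hK, one_sub_smul_gain_mul_mul_transpose hBT, reduced_gain_quadratic hs hR]
    simp only [K, Matrix.sub_mul, Matrix.one_mul, Matrix.smul_mul]
  refine ⟨hcov, fun P _ Xb hXb => ?_⟩
  rw [← hcov]
  generalize 1 - Ktilde * H = A
  rw [hXb]
  simp only [transpose_mul, Matrix.mul_smul, Matrix.smul_mul, Matrix.mul_assoc]
end

section
/- Let Xᵇ ∈ ℝ^{N×P} with P ≥ 2, H an M×N real matrix, and R an M×M symmetric positive definite real matrix. Set B = (1/(P−1))Xᵇ(Xᵇ)ᵀ, Y = HXᵇ, and Â = ((P−1)I_P + YᵀR⁻¹Y)⁻¹ (a P×P matrix). Then the matrix (P−1)I_P + YᵀR⁻¹Y is invertible, and Xᵇ Â (Xᵇ)ᵀ = (I − KH)B, where K = BHᵀ(HBHᵀ + R)⁻¹ is the Kalman gain. That is, the ETKF analysis covariance A = Xᵇ Â (Xᵇ)ᵀ satisfies the Kalman filter analysis covariance equation. -/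
open Matrix

/-- The ETKF analysis covariance `Xᵇ Â (Xᵇ)ᵀ`, with
`Â = ((P−1)I + YᵀR⁻¹Y)⁻¹` and `Y = HXᵇ`, equals the Kalman analysis
covariance `(I − KH)B`; moreover `(P−1)I + YᵀR⁻¹Y` is invertible. -/
theorem etkf_analysis_covariance (N M P : ℕ) (hP : 2 ≤ P)
    (Xb : Matrix (Fin N) (Fin P) ℝ)
    (H : Matrix (Fin M) (Fin N) ℝ) (R : Matrix (Fin M) (Fin M) ℝ)
    (hR : R.PosDef) :
    let B : Matrix (Fin N) (Fin N) ℝ := ((P : ℝ) - 1)⁻¹ • (Xb * Xbᵀ)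
    let Y : Matrix (Fin M) (Fin P) ℝ := H * Xb
    let Ahat : Matrix (Fin P) (Fin P) ℝ :=
      (((P : ℝ) - 1) • (1 : Matrix (Fin P) (Fin P) ℝ) + Yᵀ * R⁻¹ * Y)⁻¹
    let K := B * Hᵀ * (H * B * Hᵀ + R)⁻¹
    IsUnit (((P : ℝ) - 1) • (1 : Matrix (Fin P) (Fin P) ℝ) + Yᵀ * R⁻¹ * Y) ∧
    Xb * Ahat * Xbᵀ = (1 - K * H) * B := by
  intro B Y Ahat K
  have hc : (0 : ℝ) < (P : ℝ) - 1 := by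
    have : (2 : ℝ) ≤ P := by exact_mod_cast hP
    linarith
  have hc1 : (((P : ℝ) - 1) • (1 : Matrix (Fin P) (Fin P) ℝ)).PosDef := Matrix.PosDef.one.smul hc
  have hinv : (((P : ℝ) - 1) • (1 : Matrix (Fin P) (Fin P) ℝ))⁻¹ = ((P : ℝ) - 1)⁻¹ • 1 :=
    Matrix.inv_eq_left_inv (by simp [smul_smul, hc.ne'])
  have hA : (((P : ℝ) - 1) • (1 : Matrix (Fin P) (Fin P) ℝ) + Yᵀ * R⁻¹ * Y).PosDef :=
    hc1.add_posSemidef (by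
      simpa [conjTranspose_eq_transpose_of_trivial] using
        hR.inv.posSemidef.conjTranspose_mul_mul_same Y)
  have hHBH : H * B * Hᵀ = ((P : ℝ) - 1)⁻¹ • (Y * Yᵀ) := by
    simp only [B, Y, Matrix.mul_smul, Matrix.smul_mul, transpose_mul, Matrix.mul_assoc]
  have hS : (H * B * Hᵀ + R).PosDef := by
    rw [hHBH]
    refine PosDef.posSemidef_add (PosSemidef.smul ?_ (inv_nonneg.2 hc.le)) hR
    simpa [conjTranspose_eq_transpose_of_trivial] using posSemidef_self_mul_conjTranspose Y
  have hS_eq : R⁻¹⁻¹ + Y * (((P : ℝ) - 1) • (1 : Matrix (Fin P) (Fin P) ℝ))⁻¹ * Yᵀ =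
      H * B * Hᵀ + R := by
    rw [nonsing_inv_nonsing_inv R ((isUnit_iff_isUnit_det R).1 hR.isUnit), hinv, hHBH, add_comm]
    simp
  refine ⟨hA.isUnit, ?_⟩
  have hAhat := add_mul_mul_inv_eq_sub _ Yᵀ R⁻¹ Y hc1.isUnit hR.inv.isUnit
    (hS_eq ▸ hS.isUnit)
  rw [hS_eq, hinv] at hAhat
  simp only [Ahat, K, hAhat]
  generalize (H * B * Hᵀ + R)⁻¹ = S
  simp only [B, Y, Matrix.mul_smul, Matrix.smul_mul, transpose_mul, Matrix.mul_assoc,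
    Matrix.mul_sub, Matrix.sub_mul, Matrix.mul_one, Matrix.one_mul, smul_sub]
end

section
/- Let R₀ > 0, k > 0 be constants, let u : ℝ → ℝ be a function, let C₀, S, C : ℝ → ℝ be differentiable functions, and let W₀, W_s, W_c ∈ ℝ. Define T(φ, t) = C₀(t) + S(t)·sin φ + C(t)·cos φ and T_w(φ) = W₀ + W_s·sin φ + W_c·cos φ. If for all t ∈ ℝ and all φ ∈ ℝ the energy equation ∂T/∂t(φ,t) + (u(t)/R₀)·∂T/∂φ(φ,t) = −k·(T(φ,t) − T_w(φ)) holds, then for all t: C₀'(t) = −k(C₀(t) − W₀), S'(t) − (u(t)/R₀)C(t) = −k(S(t) − W_s) and C'(t) + (u(t)/R₀)S(t) = −k(C(t) − W_c). -/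
/-- The lowest-mode Fourier ansatz `T(φ,t) = C₀(t) + S(t) sin φ + C(t) cos φ`
reduces the cross-sectionally averaged energy equation
`∂T/∂t + (u/R₀) ∂T/∂φ = −k (T − T_w)` to three ordinary differential
equations for the Fourier coefficients. -/
theorem energy_equation_fourier_reduction
    (R₀ k : ℝ) (hR₀ : 0 < R₀) (hk : 0 < k)
    (u : ℝ → ℝ) (C₀ S C : ℝ → ℝ)
    (hC₀ : Differentiable ℝ C₀) (hS : Differentiable ℝ S)
    (hC : Differentiable ℝ C)
    (W₀ Ws Wc : ℝ)
    (heq : ∀ t φ : ℝ,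
      deriv (fun τ => C₀ τ + S τ * Real.sin φ + C τ * Real.cos φ) t +
        (u t / R₀) *
          deriv (fun ψ => C₀ t + S t * Real.sin ψ + C t * Real.cos ψ) φ =
      -k * ((C₀ t + S t * Real.sin φ + C t * Real.cos φ) -
            (W₀ + Ws * Real.sin φ + Wc * Real.cos φ))) :
    ∀ t : ℝ,
      deriv C₀ t = -k * (C₀ t - W₀) ∧
      deriv S t - (u t / R₀) * C t = -k * (S t - Ws) ∧
      deriv C t + (u t / R₀) * S t = -k * (C t - Wc) := by
  intro t
  have hT (φ : ℝ) : deriv C₀ t + deriv S t * Real.sin φ + deriv C t * Real.cos φ +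
      (u t / R₀) * (S t * Real.cos φ - C t * Real.sin φ) =
      -k * ((C₀ t + S t * Real.sin φ + C t * Real.cos φ) -
            (W₀ + Ws * Real.sin φ + Wc * Real.cos φ)) := by
    have htime := (((hC₀ t).hasDerivAt.add ((hS t).hasDerivAt.mul_const (Real.sin φ))).add
      ((hC t).hasDerivAt.mul_const (Real.cos φ))).deriv
    have hangle := ((((Real.hasDerivAt_sin φ).const_mul (S t)).const_add (C₀ t)).add
      ((Real.hasDerivAt_cos φ).const_mul (C t))).deriv
    have h := heq t φ
    erw [htime, hangle] at h
    linear_combination h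
  have h_zero := hT 0
  have h_pi := hT Real.pi
  have h_half := hT (Real.pi / 2)
  simp only [Real.sin_zero, Real.cos_zero] at h_zero
  simp only [Real.sin_pi, Real.cos_pi] at h_pi
  simp only [Real.sin_pi_div_two, Real.cos_pi_div_two] at h_half
  refine ⟨?_, ?_, ?_⟩
  · linear_combination (h_zero + h_pi) / 2
  · linear_combination h_half - (h_zero + h_pi) / 2
  · linear_combination (h_zero - h_pi) / 2
end
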